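/- For all τ in the complex upper half-plane and all z ∈ ℂ with ϑ01(τ,z) ≠ 0: (ϑ10(τ,z)/ϑ01(τ,z))·[ (η(2τ)⁵/(η(τ)²η(4τ)²))·ϑ00(2τ,2z) − 2·(η(4τ)²/η(2τ))·ϑ10(2τ,2z) + ϑ01(2τ,2z) ] = ϑ01(τ,z)·ϑ10(τ,z) + (η(2τ)/η(τ)²)·ϑ00(τ,z)·ϑ10(τ,z). (This identity converts the formula of Proposition 9.1 of [W2022a] for the character of the N=3 module H(Λ^{[K(4),1]}) into the product form (i/2)·(1/(η(τ/2)η(2τ)))·[ϑ01·ϑ10 + (η(2τ)/η(τ)²)·ϑ00·ϑ10].) -/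

import Mathlib

open Complex

/-- Jacobi theta function `θ_{j,m}(τ,z) = Σ_{n ∈ j/(2m)+ℤ} q^{m n²} e^{2πi m n z}`. -/
noncomputable def jTheta (j m : ℝ) (τ z : ℂ) : ℂ :=
  ∑' n : ℤ, Complex.exp (2 * (Real.pi : ℂ) * Complex.I * (m : ℂ) *
    (((j / (2 * m) + (n : ℝ) : ℝ) : ℂ) ^ 2 * τ + ((j / (2 * m) + (n : ℝ) : ℝ) : ℂ) * z))

/-- `q^a := e^{2πiaτ}`. -/
noncomputable def qpow (τ : ℂ) (a : ℝ) : ℂ :=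
  Complex.exp (2 * (Real.pi : ℂ) * Complex.I * (a : ℂ) * τ)

/-- Dedekind eta function. -/
noncomputable def dedekindEta (τ : ℂ) : ℂ :=
  Complex.exp ((Real.pi : ℂ) * Complex.I * τ / 12) *
    ∏' n : ℕ, (1 - Complex.exp (2 * (Real.pi : ℂ) * Complex.I * ((n : ℂ) + 1) * τ))

/-- Mumford theta `ϑ00`. -/
noncomputable def v00 (τ z : ℂ) : ℂ := jTheta 0 2 τ z + jTheta 2 2 τ z
/-- Mumford theta `ϑ01`. -/
noncomputable def v01 (τ z : ℂ) : ℂ := jTheta 0 2 τ z - jTheta 2 2 τ z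
/-- Mumford theta `ϑ10`. -/
noncomputable def v10 (τ z : ℂ) : ℂ := jTheta 1 2 τ z + jTheta (-1) 2 τ z

open Filter Topology Finset

lemma norm_pow_two_lt_one {q : ℂ} (hq : ‖q‖ < 1) : ‖q ^ 2‖ < 1 := by
  rw [norm_pow]; exact pow_lt_one₀ (norm_nonneg _) hq two_ne_zero

/-- The finite `q`-Pochhammer symbol `(q; q)_m`. -/
noncomputable def qFactorial (q : ℂ) (m : ℕ) : ℂ := ∏ i ∈ range m, (1 - q ^ (i + 1))

/-- The inverse of `(q; q)_m`, extended by zero to negative `m`. -/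
noncomputable def invQFactorial (q : ℂ) (m : ℤ) : ℂ :=
  if m < 0 then 0 else (qFactorial q m.toNat)⁻¹

lemma one_sub_pow_succ_ne_zero {q : ℂ} (hq : ‖q‖ < 1) (n : ℕ) : 1 - q ^ (n + 1) ≠ 0 := by
  intro h
  have h1 : ‖q ^ (n + 1)‖ = 1 := by rw [← sub_eq_zero.1 h, norm_one]
  rw [norm_pow] at h1
  exact absurd h1 (pow_lt_one₀ (norm_nonneg _) hq (Nat.succ_ne_zero n)).ne

lemma qFactorial_ne_zero {q : ℂ} (hq : ‖q‖ < 1) (m : ℕ) : qFactorial q m ≠ 0 :=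
  prod_ne_zero_iff.2 fun _ _ ↦ one_sub_pow_succ_ne_zero hq _

lemma qFactorial_succ (q : ℂ) (m : ℕ) :
    qFactorial q (m + 1) = qFactorial q m * (1 - q ^ (m + 1)) :=
  prod_range_succ _ _

lemma invQFactorial_sub_one {q : ℂ} (hq : ‖q‖ < 1) (m : ℤ) :
    invQFactorial q (m - 1) = (1 - q ^ m) * invQFactorial q m := by
  rcases lt_trichotomy m 0 with h | rfl | h
  · simp [invQFactorial, h, show m - 1 < 0 by omega]
  · simp [invQFactorial]
  · obtain ⟨k, rfl⟩ : ∃ k : ℕ, m = k + 1 := ⟨(m - 1).toNat, by omega⟩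
    have h1 : ¬ ((k : ℤ) + 1 < 0) := by omega
    have h2 : ((k : ℤ) + 1).toNat = k + 1 := by omega
    have h3 := one_sub_pow_succ_ne_zero hq k
    simp only [invQFactorial, add_sub_cancel_right, h1, h2, qFactorial_succ, mul_inv, if_false,
      Int.toNat_natCast, show ¬ ((k : ℤ) < 0) by omega]
    rw [show q ^ ((k : ℤ) + 1) = q ^ (k + 1) by exact_mod_cast zpow_natCast q (k + 1)]
    field_simp

/-- The finite form of the Jacobi triple product. -/
lemma hasSum_finite_triple_product {q x : ℂ} (hq : ‖q‖ < 1) (hq0 : q ≠ 0) (hx : x ≠ 0) (N : ℕ) :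
    HasSum (fun n : ℤ ↦ qFactorial (q ^ 2) (2 * N) * invQFactorial (q ^ 2) (N - n) *
        invQFactorial (q ^ 2) (N + n) * (q ^ (n ^ 2) * x ^ n))
      (∏ k ∈ range N, ((1 + x * q ^ (2 * k + 1)) * (1 + x⁻¹ * q ^ (2 * k + 1)))) := by
  have hQ : ‖q ^ 2‖ < 1 := norm_pow_two_lt_one hq
  induction N with
  | zero =>
    convert hasSum_single (0 : ℤ) ?_ using 1
    · simp [qFactorial, invQFactorial]
    · intro n hn
      rcases lt_or_gt_of_ne hn with h | h
      · simp [invQFactorial, h]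
      · simp [invQFactorial, h]
  | succ N ih =>
    have hl := (Equiv.subRight (1 : ℤ)).hasSum_iff.2 ih
    have hr := (Equiv.addRight (1 : ℤ)).hasSum_iff.2 ih
    rw [prod_range_succ]
    set p := ∏ k ∈ range N, ((1 + x * q ^ (2 * k + 1)) * (1 + x⁻¹ * q ^ (2 * k + 1)))
    have hp : p * ((1 + x * q ^ (2 * N + 1)) * (1 + x⁻¹ * q ^ (2 * N + 1))) =
        (1 + q ^ (4 * N + 2)) * p + q ^ (2 * N + 1) * x * p + q ^ (2 * N + 1) * x⁻¹ * p := by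
      field_simp
      ring
    rw [hp]
    refine Eq.mp (congrArg (HasSum · _) (funext fun n ↦ ?_)) (((ih.mul_left (1 + q ^ (4 * N + 2))).add
      (hl.mul_left (q ^ (2 * N + 1) * x))).add (hr.mul_left (q ^ (2 * N + 1) * x⁻¹)))
    · simp only [Function.comp_apply, Equiv.subRight_apply, Equiv.coe_addRight]
      set A := invQFactorial (q ^ 2) (N + 1 - n) with hA
      set B := invQFactorial (q ^ 2) (N + 1 + n) with hB
      set u := (q ^ 2) ^ ((N : ℤ) + 1 - n) with hu
      set v := (q ^ 2) ^ ((N : ℤ) + 1 + n) with hv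
      have hq2 : q ^ 2 ≠ 0 := pow_ne_zero 2 hq0
      have e1 : invQFactorial (q ^ 2) (N - n) = (1 - u) * A := by
        rw [hu, hA, ← invQFactorial_sub_one hQ]; congr 1; ring
      have e2 : invQFactorial (q ^ 2) (N + n) = (1 - v) * B := by
        rw [hv, hB, ← invQFactorial_sub_one hQ]; congr 1; ring
      have e3 : invQFactorial (q ^ 2) (N + (n - 1)) = (1 - v / q ^ 2) * ((1 - v) * B) := by
        rw [← e2, hv, div_eq_mul_inv, ← zpow_sub_one₀ hq2, ← add_sub_assoc, invQFactorial_sub_one hQ]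
        ring_nf
      have e4 : invQFactorial (q ^ 2) (N - (n + 1)) = (1 - u / q ^ 2) * ((1 - u) * A) := by
        rw [← e1, hu, div_eq_mul_inv, ← zpow_sub_one₀ hq2, ← sub_sub, invQFactorial_sub_one hQ]
        ring_nf
      have e5 : q ^ (2 * N + 1) * x * (q ^ ((n - 1) ^ 2) * x ^ (n - 1)) =
          u * (q ^ (n ^ 2) * x ^ n) := by
        rw [zpow_sub_one₀ hx, hu, ← zpow_natCast, ← zpow_natCast, ← zpow_mul]
        field_simp
        rw [← zpow_add₀ hq0, ← zpow_add₀ hq0]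
        congr 1; push_cast; ring
      have e6 : q ^ (2 * N + 1) * x⁻¹ * (q ^ ((n + 1) ^ 2) * x ^ (n + 1)) =
          v * (q ^ (n ^ 2) * x ^ n) := by
        rw [zpow_add_one₀ hx, hv, ← zpow_natCast, ← zpow_natCast, ← zpow_mul]
        field_simp
        rw [← zpow_add₀ hq0, ← zpow_add₀ hq0]
        congr 1; push_cast; ring
      have e7 : u * v = (q ^ 2) ^ (2 * N + 2) := by
        rw [hu, hv, ← zpow_add₀ hq2, ← zpow_natCast (q ^ 2)]; congr 1; push_cast; ring
      have e8 : q ^ (4 * N + 2) = u * v / q ^ 2 := by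
        rw [e7]; field_simp; ring
      have e9 : (q ^ 2) ^ (2 * N + 1) = u * v / q ^ 2 := by
        rw [e7, pow_succ _ (2 * N + 1), mul_div_cancel_right₀ _ hq2]
      rw [show (N : ℤ) - (n - 1) = N + 1 - n by ring, show (N : ℤ) + (n + 1) = N + 1 + n by ring,
        ← hA, ← hB, e1, e2, e3, e4, show 2 * (N + 1) = 2 * N + 1 + 1 by ring, qFactorial_succ,
        qFactorial_succ, e9, show 2 * N + 1 + 1 = 2 * N + 2 by ring, ← e7, e8]
      push_cast
      rw [← hA, ← hB]
      set T := q ^ (n ^ 2) * x ^ n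
      set F := qFactorial (q ^ 2) (2 * N)
      linear_combination (F * A * ((1 - v / q ^ 2) * ((1 - v) * B))) * e5 +
        (F * ((1 - u / q ^ 2) * ((1 - u) * A)) * B) * e6

lemma tendsto_qFactorial {q : ℂ} (hq : ‖q‖ < 1) :
    Tendsto (qFactorial q) atTop (𝓝 (∏' n : ℕ, (1 - q ^ (n + 1)))) :=
  (ModularForm.multipliable_one_sub_pow hq).tendsto_prod_tprod_nat

lemma multipliable_one_add_mul_pow {q : ℂ} (hq : ‖q‖ < 1) (x : ℂ) :
    Multipliable fun n : ℕ ↦ 1 + x * q ^ n := by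
  apply multipliable_one_add_of_summable
  simpa using (summable_geometric_of_lt_one (norm_nonneg _) hq).mul_left ‖x‖

lemma multipliable_one_add_mul_pow_odd {q : ℂ} (hq : ‖q‖ < 1) (x : ℂ) :
    Multipliable fun n : ℕ ↦ 1 + x * q ^ (2 * n + 1) := by
  have hQ : ‖q ^ 2‖ < 1 := norm_pow_two_lt_one hq
  refine (multipliable_one_add_mul_pow hQ (x * q)).congr fun n ↦ ?_
  ring

lemma tprod_one_sub_pow_ne_zero {q : ℂ} (hq : ‖q‖ < 1) : ∏' n : ℕ, (1 - q ^ (n + 1)) ≠ 0 := by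
  simp_rw [sub_eq_add_neg]
  refine tprod_one_add_ne_zero_of_summable (f := fun n : ℕ ↦ -q ^ (n + 1)) (fun n ↦ ?_) ?_
  · simpa [sub_eq_add_neg] using one_sub_pow_succ_ne_zero hq n
  · simpa using (summable_nat_add_iff 1).mpr (summable_geometric_of_lt_one (norm_nonneg _) hq)

/-- The Jacobi triple product identity. -/
theorem triple_product {q x : ℂ} (hq : ‖q‖ < 1) (hq0 : q ≠ 0) (hx : x ≠ 0)
    (hs : Summable fun n : ℤ ↦ ‖q ^ (n ^ 2) * x ^ n‖) :
    ∑' n : ℤ, q ^ (n ^ 2) * x ^ n =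
      (∏' n : ℕ, (1 - (q ^ 2) ^ (n + 1))) * ((∏' n : ℕ, (1 + x * q ^ (2 * n + 1))) *
        ∏' n : ℕ, (1 + x⁻¹ * q ^ (2 * n + 1))) := by
  have hQ : ‖q ^ 2‖ < 1 := norm_pow_two_lt_one hq
  set P := ∏' n : ℕ, (1 - (q ^ 2) ^ (n + 1)) with hP
  have hP0 : P ≠ 0 := tprod_one_sub_pow_ne_zero hQ
  have hF : Tendsto (qFactorial (q ^ 2)) atTop (𝓝 P) := tendsto_qFactorial hQ
  have hI : Tendsto (invQFactorial (q ^ 2)) atTop (𝓝 P⁻¹) := by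
    have htoNat : Tendsto Int.toNat atTop atTop :=
      tendsto_atTop.2 fun b ↦ (eventually_ge_atTop (b : ℤ)).mono fun n hn ↦ by omega
    refine ((hF.comp htoNat).inv₀ hP0).congr' ?_
    filter_upwards [eventually_ge_atTop 0] with n hn
    simp [invQFactorial, not_lt.2 hn]
  obtain ⟨C, hC⟩ := hF.norm.bddAbove_range
  obtain ⟨D, hD⟩ := (hF.inv₀ hP0).norm.bddAbove_range
  have hC' (n : ℕ) : ‖qFactorial (q ^ 2) n‖ ≤ C := hC ⟨n, rfl⟩
  have hD0 : 0 ≤ D := (norm_nonneg _).trans (hD ⟨0, rfl⟩)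
  have hC0 : 0 ≤ C := (norm_nonneg _).trans (hC' 0)
  have hD' (n : ℤ) : ‖invQFactorial (q ^ 2) n‖ ≤ D := by
    unfold invQFactorial
    split_ifs
    · simpa using hD0
    · exact hD ⟨_, rfl⟩
  have hlim := tendsto_tsum_of_dominated_convergence (𝓕 := atTop)
    (f := fun (N : ℕ) (n : ℤ) ↦ qFactorial (q ^ 2) (2 * N) * invQFactorial (q ^ 2) (N - n) *
        invQFactorial (q ^ 2) (N + n) * (q ^ (n ^ 2) * x ^ n))
    (g := fun n : ℤ ↦ P * P⁻¹ * P⁻¹ * (q ^ (n ^ 2) * x ^ n))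
    (hs.mul_left (C * D * D)) (fun n ↦ ?_) (.of_forall fun N n ↦ ?_)
  · simp_rw [fun N ↦ (hasSum_finite_triple_product hq hq0 hx N).tsum_eq] at hlim
    have hprod := ((multipliable_one_add_mul_pow_odd hq x).tendsto_prod_tprod_nat).mul
      (multipliable_one_add_mul_pow_odd hq x⁻¹).tendsto_prod_tprod_nat
    simp_rw [prod_mul_distrib] at hlim
    rw [← tendsto_nhds_unique hlim hprod, tsum_mul_left]
    field_simp
  · refine Tendsto.mul_const _ (((hF.comp ?_).mul (hI.comp ?_)).mul (hI.comp ?_))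
    · exact tendsto_id.const_mul_atTop' two_pos
    · exact tendsto_atTop_add_const_right _ _ tendsto_natCast_atTop_atTop
    · exact tendsto_atTop_add_const_right _ _ tendsto_natCast_atTop_atTop
  · rw [norm_mul, norm_mul, norm_mul]
    gcongr
    exacts [hC' _, hD' _, hD' _]

lemma tsum_int_even_add_odd {f : ℤ → ℂ} (hf : Summable f) :
    ∑' k : ℤ, f (2 * k) + ∑' k : ℤ, f (2 * k + 1) = ∑' n : ℤ, f n := by
  have h2 : Function.Injective fun k : ℤ ↦ 2 * k := fun a b h ↦ by simpa using h
  have h3 : Function.Injective fun k : ℤ ↦ 2 * k + 1 := fun a b h ↦ by simpa using h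
  have he := h2.hasSum_range_iff.2 (hf.comp_injective h2).hasSum
  have ho := h3.hasSum_range_iff.2 (hf.comp_injective h3).hasSum
  refine (he.add_isCompl ?_ ho).tsum_eq.symm
  rw [← compl_eq_iff_isCompl]
  ext n
  simp only [Set.mem_compl_iff, Set.mem_range, not_exists]
  constructor
  · intro h
    have := h (n / 2)
    exact ⟨n / 2, by omega⟩
  · rintro ⟨k, rfl⟩ m
    omega

lemma summable_jacobiTheta₂_term (z : ℂ) {τ : ℂ} (hτ : 0 < τ.im) :
    Summable fun n : ℤ ↦ jacobiTheta₂_term n z τ :=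
  (summable_jacobiTheta₂_term_iff z τ).2 hτ

lemma v00_eq_jacobiTheta₂ {τ : ℂ} (hτ : 0 < τ.im) (z : ℂ) : v00 τ z = jacobiTheta₂ z τ := by
  rw [jacobiTheta₂, ← tsum_int_even_add_odd (summable_jacobiTheta₂_term z hτ), v00, jTheta, jTheta]
  congr 1 <;>
  · refine tsum_congr fun n ↦ ?_
    rw [jacobiTheta₂_term]
    congr 1
    push_cast
    ring

lemma v01_eq_jacobiTheta₂ {τ : ℂ} (hτ : 0 < τ.im) (z : ℂ) :
    v01 τ z = jacobiTheta₂ (z + 1 / 2) τ := by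
  rw [jacobiTheta₂, ← tsum_int_even_add_odd (summable_jacobiTheta₂_term _ hτ), v01, jTheta, jTheta,
    sub_eq_add_neg, ← tsum_neg]
  congr 1
  · refine tsum_congr fun n ↦ ?_
    exact Complex.exp_eq_exp_iff_exists_int.2 ⟨-n, by push_cast; ring⟩
  · refine tsum_congr fun n ↦ ?_
    rw [← mul_neg_one, ← exp_pi_mul_I, ← Complex.exp_add]
    exact Complex.exp_eq_exp_iff_exists_int.2 ⟨-n, by push_cast; ring⟩

lemma v10_eq_jacobiTheta₂ {τ : ℂ} (hτ : 0 < τ.im) (z : ℂ) :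
    v10 τ z = Complex.exp (Real.pi * I * τ / 4 + Real.pi * I * z) *
      jacobiTheta₂ (z + τ / 2) τ := by
  rw [jacobiTheta₂, ← tsum_int_even_add_odd (summable_jacobiTheta₂_term _ hτ), v10, jTheta, jTheta,
    mul_add, ← tsum_mul_left, ← tsum_mul_left,
    ← (Equiv.addRight (1 : ℤ)).tsum_eq fun n : ℤ ↦ Complex.exp (2 * (Real.pi : ℂ) * I *
      ((2 : ℝ) : ℂ) * (((-1 / (2 * 2) + (n : ℝ) : ℝ) : ℂ) ^ 2 * τ +
        ((-1 / (2 * 2) + (n : ℝ) : ℝ) : ℂ) * z))]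
  congr 1 <;>
  · refine tsum_congr fun n ↦ ?_
    rw [jacobiTheta₂_term, ← Complex.exp_add]
    congr 1
    push_cast [Equiv.coe_addRight]
    ring

/-- The addition formula for products of two theta functions. -/
lemma jacobiTheta₂_mul_jacobiTheta₂ (z w : ℂ) {τ : ℂ} (hτ : 0 < τ.im) :
    jacobiTheta₂ z τ * jacobiTheta₂ w τ =
      jacobiTheta₂ (z + w) (2 * τ) * jacobiTheta₂ (z - w) (2 * τ) +
        Complex.exp (Real.pi * I * τ + 2 * Real.pi * I * z) *
          (jacobiTheta₂ (z + w + τ) (2 * τ) * jacobiTheta₂ (z - w + τ) (2 * τ)) := by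
  let e : ℤ × ℤ ≃ ℤ × ℤ :=
    { toFun := fun p ↦ (p.2 + p.1, p.2)
      invFun := fun p ↦ (p.1 - p.2, p.2)
      left_inv := fun p ↦ by simp
      right_inv := fun p ↦ by simp }
  have hz := (summable_jacobiTheta₂_term z hτ).norm
  have hw := (summable_jacobiTheta₂_term w hτ).norm
  have hs : Summable fun p ↦ jacobiTheta₂_term (e p).1 z τ * jacobiTheta₂_term (e p).2 w τ :=
    e.summable_iff.2 (summable_mul_of_summable_norm hz hw)
  rw [jacobiTheta₂, jacobiTheta₂, tsum_mul_tsum_of_summable_norm hz hw, ← e.tsum_eq,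
    Summable.tsum_prod hs, ← tsum_int_even_add_odd hs.prod]
  congr 1
  · rw [jacobiTheta₂, jacobiTheta₂, ← tsum_mul_left]
    refine tsum_congr fun b ↦ ?_
    rw [← tsum_mul_right, ← (Equiv.subRight b).tsum_eq]
    refine tsum_congr fun a ↦ ?_
    simp only [e, Equiv.coe_fn_mk, Equiv.subRight_apply, jacobiTheta₂_term, ← Complex.exp_add]
    congr 1
    push_cast
    ring
  · rw [jacobiTheta₂, jacobiTheta₂, ← tsum_mul_left, ← tsum_mul_left]
    refine tsum_congr fun b ↦ ?_
    rw [← tsum_mul_right, ← tsum_mul_left, ← (Equiv.subRight b).tsum_eq]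
    refine tsum_congr fun a ↦ ?_
    simp only [e, Equiv.coe_fn_mk, Equiv.subRight_apply, jacobiTheta₂_term, ← Complex.exp_add]
    congr 1
    push_cast
    ring

lemma im_two_mul_pos {τ : ℂ} (hτ : 0 < τ.im) : 0 < (2 * τ).im := by simpa using hτ

lemma v01_sq {τ : ℂ} (hτ : 0 < τ.im) (z : ℂ) :
    v01 τ z ^ 2 = v00 (2 * τ) 0 * v00 (2 * τ) (2 * z) - v10 (2 * τ) 0 * v10 (2 * τ) (2 * z) := by
  have h2 := im_two_mul_pos hτ
  rw [v01_eq_jacobiTheta₂ hτ, sq, jacobiTheta₂_mul_jacobiTheta₂ _ _ hτ, v00_eq_jacobiTheta₂ h2,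
    v00_eq_jacobiTheta₂ h2, v10_eq_jacobiTheta₂ h2, v10_eq_jacobiTheta₂ h2,
    show z + 1 / 2 + (z + 1 / 2) = 2 * z + 1 by ring, sub_self, jacobiTheta₂_add_left,
    show 2 * z + 1 + τ = 2 * z + τ + 1 by ring, jacobiTheta₂_add_left,
    mul_div_cancel_left₀ τ two_ne_zero, sub_eq_add_neg, mul_comm (jacobiTheta₂ 0 _)]
  congr 1
  have : Complex.exp (Real.pi * I * τ + 2 * Real.pi * I * (z + 1 / 2)) =
      -(Complex.exp (Real.pi * I * (2 * τ) / 4 + Real.pi * I * 0) *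
        Complex.exp (Real.pi * I * (2 * τ) / 4 + Real.pi * I * (2 * z))) := by
    rw [← mul_neg_one, ← exp_pi_mul_I, ← Complex.exp_add, ← Complex.exp_add]
    ring_nf
  rw [this]
  ring

lemma jacobiTheta₂_half_period (τ : ℂ) : jacobiTheta₂ (-(1 / 2) + τ) (2 * τ) = 0 := by
  have h1 : jacobiTheta₂ (-(1 / 2) + τ) (2 * τ) = jacobiTheta₂ (-(1 / 2) - τ) (2 * τ) := by
    rw [← jacobiTheta₂_neg_left, ← jacobiTheta₂_add_left (-(1 / 2) - τ)]
    ring_nf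
  have h2 := jacobiTheta₂_add_left' (-(1 / 2) - τ) (2 * τ)
  rw [show -(1 / 2) - τ + 2 * τ = -(1 / 2) + τ by ring,
    show -(Real.pi : ℂ) * I * (2 * τ + 2 * (-(1 / 2) - τ)) = Real.pi * I by ring, exp_pi_mul_I,
    ← h1] at h2
  linear_combination h2 / 2

lemma v00_mul_v01 {τ : ℂ} (hτ : 0 < τ.im) (z : ℂ) :
    v00 τ z * v01 τ z = v01 (2 * τ) 0 * v01 (2 * τ) (2 * z) := by
  have h2 := im_two_mul_pos hτ
  rw [v01_eq_jacobiTheta₂ hτ, v00_eq_jacobiTheta₂ hτ, jacobiTheta₂_mul_jacobiTheta₂ _ _ hτ,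
    v01_eq_jacobiTheta₂ h2, v01_eq_jacobiTheta₂ h2,
    show z - (z + 1 / 2) = -(1 / 2) by ring, jacobiTheta₂_half_period, jacobiTheta₂_neg_left,
    zero_add, ← add_assoc, ← two_mul]
  ring

/-- Euler's product `∏ (1 - q ^ n)` over `n ≥ 1`. -/
noncomputable def eulerProd (q : ℂ) : ℂ := ∏' n : ℕ, (1 - q ^ (n + 1))

lemma jacobiTheta₂_eq_triple_product (z : ℂ) {τ : ℂ} (hτ : 0 < τ.im) {q x : ℂ}
    (hq : q = Complex.exp (Real.pi * I * τ)) (hx : x = Complex.exp (2 * Real.pi * I * z)) :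
    jacobiTheta₂ z τ = eulerProd (q ^ 2) * ((∏' n : ℕ, (1 + x * q ^ (2 * n + 1))) *
        ∏' n : ℕ, (1 + x⁻¹ * q ^ (2 * n + 1))) := by
  have hterm (n : ℤ) : jacobiTheta₂_term n z τ = q ^ (n ^ 2) * x ^ n := by
    rw [hq, hx, ← Complex.exp_int_mul, ← Complex.exp_int_mul, ← Complex.exp_add, jacobiTheta₂_term]
    congr 1
    push_cast
    ring
  have hq1 : ‖q‖ < 1 := by
    rw [hq, Complex.norm_exp, Real.exp_lt_one_iff]
    simpa using mul_pos Real.pi_pos hτ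
  have hs := (summable_jacobiTheta₂_term z hτ).norm
  rw [jacobiTheta₂]
  simp_rw [hterm] at hs ⊢
  exact triple_product hq1 (hq ▸ Complex.exp_ne_zero _) (hx ▸ Complex.exp_ne_zero _) hs

lemma eulerProd_ne_zero {q : ℂ} (hq : ‖q‖ < 1) : eulerProd q ≠ 0 := tprod_one_sub_pow_ne_zero hq

lemma eulerProd_eq_mul_odd {q : ℂ} (hq : ‖q‖ < 1) :
    eulerProd q = (∏' n : ℕ, (1 + -1 * q ^ (2 * n + 1))) * eulerProd (q ^ 2) := by
  have h1 (n : ℕ) : 1 + -1 * q ^ (2 * n + 1) = 1 - q ^ (2 * n + 1) := by ring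
  have h2 (n : ℕ) : 1 - (q ^ 2) ^ (n + 1) = 1 - q ^ (2 * n + 1 + 1) := by ring
  have m1 := multipliable_one_add_mul_pow_odd hq (-1)
  have m2 := ModularForm.multipliable_one_sub_pow (norm_pow_two_lt_one hq)
  simp_rw [h1] at m1
  simp_rw [h2] at m2
  simp_rw [eulerProd, h1, h2]
  exact (tprod_even_mul_odd (f := fun n ↦ 1 - q ^ (n + 1)) m1 m2).symm

lemma multipliable_one_add_pow_succ {q : ℂ} (hq : ‖q‖ < 1) :
    Multipliable fun n : ℕ ↦ 1 + q ^ (n + 1) :=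
  (multipliable_one_add_mul_pow hq q).congr fun n ↦ by ring

lemma eulerProd_mul_tprod_one_add {q : ℂ} (hq : ‖q‖ < 1) :
    eulerProd q * ∏' n : ℕ, (1 + q ^ (n + 1)) = eulerProd (q ^ 2) := by
  rw [eulerProd, ← (ModularForm.multipliable_one_sub_pow hq).tprod_mul
    (multipliable_one_add_pow_succ hq), eulerProd]
  exact tprod_congr fun n ↦ by ring

lemma tprod_one_add_eq_mul_odd {q : ℂ} (hq : ‖q‖ < 1) :
    ∏' n : ℕ, (1 + q ^ (n + 1)) =
      (∏' n : ℕ, (1 + 1 * q ^ (2 * n + 1))) * ∏' n : ℕ, (1 + (q ^ 2) ^ (n + 1)) := by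
  have h1 (n : ℕ) : 1 + 1 * q ^ (2 * n + 1) = 1 + q ^ (2 * n + 1) := by ring
  have h2 (n : ℕ) : 1 + (q ^ 2) ^ (n + 1) = 1 + q ^ (2 * n + 1 + 1) := by ring
  have m1 := multipliable_one_add_mul_pow_odd hq 1
  have m2 := multipliable_one_add_pow_succ (norm_pow_two_lt_one hq)
  simp_rw [h1] at m1
  simp_rw [h2] at m2
  simp_rw [h1, h2]
  exact (tprod_even_mul_odd (f := fun n ↦ 1 + q ^ (n + 1)) m1 m2).symm

lemma tprod_one_add_odd {q : ℂ} (hq : ‖q‖ < 1) :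
    ∏' n : ℕ, (1 + 1 * q ^ (2 * n + 1)) =
      eulerProd (q ^ 2) ^ 2 / (eulerProd q * eulerProd (q ^ 4)) := by
  have hq2 := norm_pow_two_lt_one hq
  have h1 := eulerProd_mul_tprod_one_add hq
  have h2 := eulerProd_mul_tprod_one_add hq2
  rw [tprod_one_add_eq_mul_odd hq] at h1
  rw [← pow_mul, show 2 * 2 = 4 from rfl] at h2
  have n1 := eulerProd_ne_zero hq
  have n4 := eulerProd_ne_zero (norm_pow_two_lt_one hq2)
  rw [← pow_mul, show 2 * 2 = 4 from rfl] at n4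
  rw [eq_div_iff (mul_ne_zero n1 n4)]
  linear_combination eulerProd (q ^ 2) * h1 -
    eulerProd q * (∏' n : ℕ, (1 + 1 * q ^ (2 * n + 1))) * h2

lemma norm_exp_two_pi_mul_I_lt_one {τ : ℂ} (hτ : 0 < τ.im) :
    ‖Complex.exp (2 * Real.pi * I * τ)‖ < 1 := by
  rw [Complex.norm_exp, Real.exp_lt_one_iff]
  simpa using mul_pos Real.two_pi_pos hτ

lemma dedekindEta_eq (τ : ℂ) : dedekindEta τ =
    Complex.exp (Real.pi * I * τ / 12) * eulerProd (Complex.exp (2 * Real.pi * I * τ)) := by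
  rw [dedekindEta, eulerProd]
  congr 1
  refine tprod_congr fun n ↦ ?_
  rw [← Complex.exp_nat_mul]
  push_cast
  ring_nf

lemma dedekindEta_nat_mul (k : ℕ) (τ : ℂ) : dedekindEta (k * τ) =
    Complex.exp (Real.pi * I * τ / 12) ^ k * eulerProd (Complex.exp (2 * Real.pi * I * τ) ^ k) := by
  rw [dedekindEta_eq, ← Complex.exp_nat_mul, ← Complex.exp_nat_mul]
  ring_nf

lemma dedekindEta_ne_zero {τ : ℂ} (hτ : 0 < τ.im) : dedekindEta τ ≠ 0 := by
  rw [dedekindEta_eq]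
  exact mul_ne_zero (Complex.exp_ne_zero _) (eulerProd_ne_zero (norm_exp_two_pi_mul_I_lt_one hτ))

lemma v00_two_mul_zero {τ : ℂ} (hτ : 0 < τ.im) : v00 (2 * τ) 0 =
    dedekindEta (2 * τ) ^ 5 / (dedekindEta τ ^ 2 * dedekindEta (4 * τ) ^ 2) := by
  have e1 := dedekindEta_nat_mul 1 τ
  have e2 := dedekindEta_nat_mul 2 τ
  have e4 := dedekindEta_nat_mul 4 τ
  push_cast at e1 e2 e4
  rw [one_mul, pow_one, pow_one] at e1
  have hq := norm_exp_two_pi_mul_I_lt_one hτ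
  rw [v00_eq_jacobiTheta₂ (im_two_mul_pos hτ), jacobiTheta₂_eq_triple_product (x := 1)
    (q := Complex.exp (2 * Real.pi * I * τ)) 0 (im_two_mul_pos hτ) (by ring_nf) (by simp),
    inv_one, tprod_one_add_odd hq, e1, e2, e4]
  field_simp

lemma v01_two_mul_zero {τ : ℂ} (hτ : 0 < τ.im) : v01 (2 * τ) 0 =
    dedekindEta τ ^ 2 / dedekindEta (2 * τ) := by
  have e2 := dedekindEta_nat_mul 2 τ
  push_cast at e2
  have hq := norm_exp_two_pi_mul_I_lt_one hτ
  have n2 := eulerProd_ne_zero (norm_pow_two_lt_one hq)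
  rw [v01_eq_jacobiTheta₂ (im_two_mul_pos hτ), jacobiTheta₂_eq_triple_product (x := -1)
    (q := Complex.exp (2 * Real.pi * I * τ)) _ (im_two_mul_pos hτ) (by ring_nf)
    (by rw [← exp_pi_mul_I]; ring_nf), dedekindEta_eq τ, e2, eulerProd_eq_mul_odd hq,
    inv_neg_one]
  field_simp

lemma tprod_one_add_pow {q : ℂ} (hq : ‖q‖ < 1) :
    ∏' n : ℕ, (1 + q ^ n) = 2 * ∏' n : ℕ, (1 + q ^ (n + 1)) := by
  have h := tprod_eq_zero_mul' (f := fun n ↦ 1 + q ^ n) (multipliable_one_add_pow_succ hq)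
  rwa [pow_zero, one_add_one_eq_two] at h

lemma v10_two_mul_zero {τ : ℂ} (hτ : 0 < τ.im) : v10 (2 * τ) 0 =
    2 * (dedekindEta (4 * τ) ^ 2 / dedekindEta (2 * τ)) := by
  have e2 := dedekindEta_nat_mul 2 τ
  have e4 := dedekindEta_nat_mul 4 τ
  push_cast at e2 e4
  have hq := norm_exp_two_pi_mul_I_lt_one hτ
  obtain ⟨q, hqdef⟩ : ∃ q, q = Complex.exp (2 * Real.pi * I * τ) := ⟨_, rfl⟩
  rw [← hqdef] at hq e2 e4
  have hq0 : q ≠ 0 := hqdef ▸ Complex.exp_ne_zero _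
  have hq2 := norm_pow_two_lt_one hq
  have n2 := eulerProd_ne_zero hq2
  have hE : Complex.exp (Real.pi * I * (2 * τ) / 4 + Real.pi * I * 0) =
      Complex.exp (Real.pi * I * τ / 12) ^ 6 := by
    rw [← Complex.exp_nat_mul]; push_cast; ring_nf
  have h1 (n : ℕ) : 1 + q * q ^ (2 * n + 1) = 1 + (q ^ 2) ^ (n + 1) := by ring
  have h2 (n : ℕ) : 1 + q⁻¹ * q ^ (2 * n + 1) = 1 + (q ^ 2) ^ n := by
    rw [pow_succ' q, inv_mul_cancel_left₀ hq0, pow_mul]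
  have hP := eulerProd_mul_tprod_one_add hq2
  rw [← pow_mul, show 2 * 2 = 4 from rfl] at hP
  rw [v10_eq_jacobiTheta₂ (im_two_mul_pos hτ), jacobiTheta₂_eq_triple_product (x := q)
    (q := q) _ (im_two_mul_pos hτ) (by rw [hqdef]; ring_nf) (by rw [hqdef]; ring_nf), e2, e4, hE]
  simp_rw [h1, h2]
  rw [tprod_one_add_pow hq2, ← hP]
  have hE0 := Complex.exp_ne_zero (Real.pi * I * τ / 12)
  generalize Complex.exp (Real.pi * I * τ / 12) = E at hE0 ⊢
  generalize eulerProd (q ^ 2) = p at n2 ⊢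
  generalize ∏' n : ℕ, (1 + (q ^ 2) ^ (n + 1)) = r
  field_simp

/-- Note 2.3 identity used to rewrite the character of `H(Λ^{[K(4),1]})`. -/
theorem stmt_9 (τ : ℂ) (hτ : 0 < τ.im) (z : ℂ) (h : v01 τ z ≠ 0) :
    (v10 τ z / v01 τ z) *
        (dedekindEta (2 * τ) ^ 5 / (dedekindEta τ ^ 2 * dedekindEta (4 * τ) ^ 2) *
            v00 (2 * τ) (2 * z)
          - 2 * (dedekindEta (4 * τ) ^ 2 / dedekindEta (2 * τ)) * v10 (2 * τ) (2 * z)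
          + v01 (2 * τ) (2 * z)) =
      v01 τ z * v10 τ z +
        (dedekindEta (2 * τ) / dedekindEta τ ^ 2) * v00 τ z * v10 τ z := by
  have h2 := im_two_mul_pos hτ
  have hs := v01_sq hτ z
  have hm := v00_mul_v01 hτ z
  have n1 := dedekindEta_ne_zero hτ
  have n2 := dedekindEta_ne_zero h2
  have hc : dedekindEta (2 * τ) / dedekindEta τ ^ 2 * v01 (2 * τ) 0 = 1 := by
    rw [v01_two_mul_zero hτ]
    field_simp
  rw [← v00_two_mul_zero hτ, ← v10_two_mul_zero hτ, div_mul_eq_mul_div, div_eq_iff h]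
  linear_combination (-v10 τ z) * hs - dedekindEta (2 * τ) / dedekindEta τ ^ 2 * v10 τ z * hm -
    v10 τ z * v01 (2 * τ) (2 * z) * hc
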